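/- For all real numbers a, b > 0 with a ≠ b, one has (A·X)^{1/2} < P < (A·X^{β₂})^{1/(1+β₂)}, where β₂ = log(π/2)/log(2e/π); moreover the exponents 2 (in (A·X)^{1/2}) and β₂ are the best possible constants. -/

import Mathlib

open Real

/-- Arithmetic mean -/
noncomputable def Am (a b : ℝ) : ℝ := (a + b) / 2

/-- Geometric mean -/
noncomputable def Gm (a b : ℝ) : ℝ := Real.sqrt (a * b)

/-- Harmonic mean -/
noncomputable def Hm (a b : ℝ) : ℝ := 2 * a * b / (a + b)

/-- Seiffert mean -/
noncomputable def Pm (a b : ℝ) : ℝ := (a - b) / (2 * Real.arcsin ((a - b) / (a + b)))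

/-- Sándor's X mean -/
noncomputable def Xm (a b : ℝ) : ℝ := Am a b * Real.exp (Gm a b / Pm a b - 1)

/-- Logarithmic mean -/
noncomputable def Lm (a b : ℝ) : ℝ := (a - b) / (Real.log a - Real.log b)

/-- Identric mean -/
noncomputable def Im (a b : ℝ) : ℝ := (1 / Real.exp 1) * ((a ^ a) / (b ^ b)) ^ (1 / (a - b))

/-- Power mean -/
noncomputable def Mp (p a b : ℝ) : ℝ :=
  if p = 0 then Real.sqrt (a * b) else ((a ^ p + b ^ p) / 2) ^ (1 / p)

/-- Power-type Heronian mean -/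
noncomputable def Hp (p a b : ℝ) : ℝ :=
  if p = 0 then Real.sqrt (a * b) else ((a ^ p + (a * b) ^ (p / 2) + b ^ p) / 3) ^ (1 / p)

/-- β₂ = log(π/2)/log(2e/π) -/
noncomputable def β₂ : ℝ := Real.log (π / 2) / Real.log (2 * Real.exp 1 / π)

/-- If the derivative of `f` stays negative after its first nonpositive value and `f 0 = 0`,
then `f` itself stays negative after its first nonpositive value. -/
theorem neg_of_nonpos_of_deriv_neg_of_nonpos {f f' : ℝ → ℝ} {c : ℝ}
    (hf : ContinuousOn f (Set.Icc 0 c)) (h0 : f 0 = 0)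
    (hd : ∀ t ∈ Set.Ioo 0 c, HasDerivAt f (f' t) t)
    (h' : ∀ x y, 0 < x → x < y → y < c → f' x ≤ 0 → f' y < 0) :
    ∀ x y, 0 < x → x < y → y ≤ c → f x ≤ 0 → f y < 0 := by
  intro x y hx hxy hyc hfx
  obtain ⟨z, hz, hfz⟩ := exists_hasDerivAt_eq_slope f f' hx
    (hf.mono (Set.Icc_subset_Icc_right (hxy.le.trans hyc)))
    fun t ht => hd t ⟨ht.1, ht.2.trans (hxy.trans_le hyc)⟩
  have hz' : f' z ≤ 0 := by
    rw [hfz, h0, sub_zero, sub_zero]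
    exact div_nonpos_of_nonpos_of_nonneg hfx hx.le
  obtain ⟨u, hu, hfu⟩ := exists_hasDerivAt_eq_slope f f' hxy
    (hf.mono (Set.Icc_subset_Icc hx.le hyc))
    fun t ht => hd t ⟨hx.trans ht.1, ht.2.trans_le hyc⟩
  have hu' : f' u < 0 := h' z u hz.1 (hz.2.trans hu.1) (hu.2.trans_le hyc) hz'
  rw [hfu, div_neg_iff] at hu'
  rcases hu' with h | h <;> linarith [h.1, h.2]

theorem neg_of_deriv_neg {f f' : ℝ → ℝ} {c : ℝ}
    (hf : ContinuousOn f (Set.Icc 0 c)) (h0 : f 0 = 0)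
    (hd : ∀ t ∈ Set.Ioo 0 c, HasDerivAt f (f' t) t)
    (h' : ∀ x ∈ Set.Ioo 0 c, f' x < 0) : ∀ x ∈ Set.Ioo 0 c, f x < 0 := by
  intro x hx
  obtain ⟨u, hu, hfu⟩ := exists_hasDerivAt_eq_slope f f' hx.1
    (hf.mono (Set.Icc_subset_Icc_right hx.2.le))
    fun t ht => hd t ⟨ht.1, ht.2.trans hx.2⟩
  have hu' := h' u ⟨hu.1, hu.2.trans hx.2⟩
  rw [hfu, div_neg_iff] at hu'
  rcases hu' with h | h <;> linarith [h.1, h.2, hx.1]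

theorem sin_pos_of_mem_Ioo_pi_div_two {t : ℝ} (ht : t ∈ Set.Ioo 0 (π / 2)) : 0 < sin t :=
  sin_pos_of_pos_of_lt_pi ht.1 (by linarith [ht.2, pi_pos])

theorem cos_pos_of_mem_Ioo_pi_div_two {t : ℝ} (ht : t ∈ Set.Ioo 0 (π / 2)) : 0 < cos t :=
  cos_pos_of_mem_Ioo ⟨by linarith [ht.1, pi_pos], ht.2⟩

theorem sinc_pos_of_mem_Icc_pi_div_two {t : ℝ} (ht : t ∈ Set.Icc 0 (π / 2)) : 0 < sinc t := by
  rcases ht.1.eq_or_lt with rfl | h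
  · simp
  · rw [sinc_of_ne_zero h.ne']
    exact div_pos (sin_pos_of_pos_of_lt_pi h (by linarith [ht.2, pi_pos])) h

/-- With `A = 1` and `sin t = (a - b) / (a + b)`, this is `log X - k * log P`. -/
noncomputable def logMeanGap (k t : ℝ) : ℝ := cos t / sinc t - 1 - k * log (sinc t)

/-- The derivative of `logMeanGap k` multiplied by `t * sin t ^ 2`. -/
noncomputable def gapNumerator (k t : ℝ) : ℝ :=
  k * sin t ^ 2 - (k - 1) * (t * (sin t * cos t)) - t ^ 2

/-- The derivative of `gapNumerator k`. -/
noncomputable def gapNumeratorDeriv (k t : ℝ) : ℝ :=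
  (k + 1) * (sin t * cos t) - (k - 1) * (t * (cos t ^ 2 - sin t ^ 2)) - 2 * t

theorem continuousOn_logMeanGap (k : ℝ) : ContinuousOn (logMeanGap k) (Set.Icc 0 (π / 2)) := by
  have h : ∀ t ∈ Set.Icc 0 (π / 2), sinc t ≠ 0 :=
    fun t ht => (sinc_pos_of_mem_Icc_pi_div_two ht).ne'
  have hs : ContinuousOn sinc (Set.Icc 0 (π / 2)) := continuous_sinc.continuousOn
  exact ((continuous_cos.continuousOn.div hs h).sub continuousOn_const).sub
    (continuousOn_const.mul (hs.log h))

theorem hasDerivAt_logMeanGap (k : ℝ) {t : ℝ} (ht : t ∈ Set.Ioo 0 (π / 2)) :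
    HasDerivAt (logMeanGap k) (gapNumerator k t / (t * sin t ^ 2)) t := by
  have hs := sin_pos_of_mem_Ioo_pi_div_two ht
  have ht0 : t ≠ 0 := ht.1.ne'
  have hsinc : HasDerivAt sinc ((cos t * t - sin t) / t ^ 2) t := by
    have h := (hasDerivAt_sin t).div (hasDerivAt_id t) ht0
    simp only [id, mul_one] at h
    refine h.congr_of_eventuallyEq ?_
    filter_upwards [eventually_ne_nhds ht0] with x hx
    simp [sinc_of_ne_zero hx]
  have hne : sinc t ≠ 0 := (sinc_pos_of_mem_Icc_pi_div_two ⟨ht.1.le, ht.2.le⟩).ne'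
  have h := (((hasDerivAt_cos t).div hsinc hne).sub_const 1).sub ((hsinc.log hne).const_mul k)
  refine h.congr_deriv ?_
  rw [sinc_of_ne_zero ht0, gapNumerator]
  have hs0 := hs.ne'
  field_simp
  have := sin_sq_add_cos_sq t
  linear_combination (-t ^ 2) * this

theorem hasDerivAt_gapNumerator (k t : ℝ) :
    HasDerivAt (gapNumerator k) (gapNumeratorDeriv k t) t := by
  have h := ((((hasDerivAt_sin t).pow 2).const_mul k).sub (((hasDerivAt_id t).mul
    ((hasDerivAt_sin t).mul (hasDerivAt_cos t))).const_mul (k - 1))).sub ((hasDerivAt_id t).pow 2)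
  refine h.congr_deriv ?_
  simp only [gapNumeratorDeriv, id, Pi.mul_apply]
  ring

theorem hasDerivAt_gapNumeratorDeriv (k t : ℝ) :
    HasDerivAt (gapNumeratorDeriv k) (4 * sin t * ((k - 1) * (t * cos t) - sin t)) t := by
  have h := ((((hasDerivAt_sin t).mul (hasDerivAt_cos t)).const_mul (k + 1)).sub
    (((hasDerivAt_id t).mul (((hasDerivAt_cos t).pow 2).sub
    ((hasDerivAt_sin t).pow 2))).const_mul (k - 1))).sub ((hasDerivAt_id t).const_mul 2)
  refine h.congr_deriv ?_
  simp only [id, Pi.sub_apply, Pi.pow_apply]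
  linear_combination 2 * sin_sq_add_cos_sq t

theorem hasDerivAt_mul_cos_sub_sin (k t : ℝ) :
    HasDerivAt (fun t => (k - 1) * (t * cos t) - sin t)
      ((k - 2) * cos t - (k - 1) * (t * sin t)) t := by
  have h := (((hasDerivAt_id t).mul (hasDerivAt_cos t)).const_mul (k - 1)).sub (hasDerivAt_sin t)
  refine h.congr_deriv ?_
  simp only [id]
  ring

theorem continuous_gapNumerator (k : ℝ) : Continuous (gapNumerator k) :=
  continuous_iff_continuousAt.2 fun t => (hasDerivAt_gapNumerator k t).continuousAt

theorem continuous_gapNumeratorDeriv (k : ℝ) : Continuous (gapNumeratorDeriv k) :=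
  continuous_iff_continuousAt.2 fun t => (hasDerivAt_gapNumeratorDeriv k t).continuousAt

theorem logMeanGap_two_neg : ∀ t ∈ Set.Ioo 0 (π / 2), logMeanGap 2 t < 0 := by
  have h2 : ∀ t ∈ Set.Ioo 0 (π / 2), gapNumeratorDeriv 2 t < 0 := by
    refine neg_of_deriv_neg (continuous_gapNumeratorDeriv 2).continuousOn
      (by simp [gapNumeratorDeriv]) (fun t _ => hasDerivAt_gapNumeratorDeriv 2 t) fun t ht => ?_
    have hs := sin_pos_of_mem_Ioo_pi_div_two ht
    have hc := cos_pos_of_mem_Ioo_pi_div_two ht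
    have := lt_tan ht.1 ht.2
    rw [tan_eq_sin_div_cos, lt_div_iff₀ hc] at this
    exact mul_neg_of_pos_of_neg (by positivity) (by linarith)
  have h1 : ∀ t ∈ Set.Ioo 0 (π / 2), gapNumerator 2 t < 0 :=
    neg_of_deriv_neg (continuous_gapNumerator 2).continuousOn (by simp [gapNumerator])
      (fun t _ => hasDerivAt_gapNumerator 2 t) h2
  refine neg_of_deriv_neg (continuousOn_logMeanGap 2) (by simp [logMeanGap])
    (fun t => hasDerivAt_logMeanGap 2) fun t ht => div_neg_of_neg_of_pos (h1 t ht) ?_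
  have := sin_pos_of_mem_Ioo_pi_div_two ht
  have := ht.1
  positivity

theorem logMeanGap_pos {k : ℝ} (hk : 2 ≤ k) (hend : 0 ≤ logMeanGap k (π / 2)) :
    ∀ t ∈ Set.Ioo 0 (π / 2), 0 < logMeanGap k t := by
  have h3 := neg_of_nonpos_of_deriv_neg_of_nonpos (c := π / 2)
    (f := fun t => (k - 1) * (t * cos t) - sin t)
    (by fun_prop) (by simp) (fun t _ => hasDerivAt_mul_cos_sub_sin k t) (by
      intro x y hx hxy hy h
      have hc : cos y < cos x := cos_lt_cos_of_nonneg_of_le_pi_div_two hx.le hy.le hxy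
      have hs : sin x < sin y := sin_lt_sin_of_lt_of_le_pi_div_two (by linarith) hy.le hxy
      have hsx := sin_pos_of_mem_Ioo_pi_div_two ⟨hx, hxy.trans hy⟩
      have h1 : x * sin x < y * sin y := mul_lt_mul'' hxy hs hx.le hsx.le
      have h2 : (k - 1) * (x * sin x) < (k - 1) * (y * sin y) :=
        mul_lt_mul_of_pos_left h1 (by linarith)
      have h3 : (k - 2) * cos y ≤ (k - 2) * cos x :=
        mul_le_mul_of_nonneg_left hc.le (by linarith)
      linarith)
  have h2 := neg_of_nonpos_of_deriv_neg_of_nonpos (c := π / 2)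
    (continuous_gapNumeratorDeriv k).continuousOn (by simp [gapNumeratorDeriv])
    (fun t _ => hasDerivAt_gapNumeratorDeriv k t) (by
      intro x y hx hxy hy h
      have hsx := sin_pos_of_mem_Ioo_pi_div_two ⟨hx, hxy.trans hy⟩
      have hsy := sin_pos_of_mem_Ioo_pi_div_two ⟨hx.trans hxy, hy⟩
      have h' := nonpos_of_mul_nonpos_right h (by positivity)
      exact mul_neg_of_pos_of_neg (by positivity) (h3 x y hx hxy hy.le h'))
  have h1 := neg_of_nonpos_of_deriv_neg_of_nonpos (c := π / 2)
    (continuous_gapNumerator k).continuousOn (by simp [gapNumerator])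
    (fun t _ => hasDerivAt_gapNumerator k t) fun x y hx hxy hy => h2 x y hx hxy hy.le
  have h0 := neg_of_nonpos_of_deriv_neg_of_nonpos (c := π / 2)
    (continuousOn_logMeanGap k) (by simp [logMeanGap])
    (fun t ht => hasDerivAt_logMeanGap k ht) (by
      intro x y hx hxy hy h
      have hsx := sin_pos_of_mem_Ioo_pi_div_two ⟨hx, hxy.trans hy⟩
      have hsy := sin_pos_of_mem_Ioo_pi_div_two ⟨hx.trans hxy, hy⟩
      have hy0 := hx.trans hxy
      have h' : gapNumerator k x ≤ 0 := by
        rwa [div_le_iff₀ (by positivity), zero_mul] at h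
      exact div_neg_of_neg_of_pos (h1 x y hx hxy hy.le h') (by positivity))
  intro t ht
  by_contra! h
  exact (h0 t (π / 2) ht.1 ht.2 le_rfl h).not_ge hend

theorem log_pi_div_two_pos : 0 < log (π / 2) := log_pos (by linarith [pi_gt_three])

theorem log_pi_div_two_lt_half : log (π / 2) < 1 / 2 := by
  have h : log ((π / 2) ^ 2) < 1 := by
    rw [log_lt_iff_lt_exp (by positivity)]
    nlinarith [exp_one_gt_d9, pi_lt_d2, pi_pos]
  rw [log_pow] at h
  push_cast at h
  linarith

theorem β₂_eq : β₂ = log (π / 2) / (1 - log (π / 2)) := by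
  have h : 2 * exp 1 / π = exp 1 / (π / 2) := by field_simp
  rw [β₂, h, log_div (exp_pos 1).ne' (by positivity), log_exp]

theorem β₂_pos : 0 < β₂ := by
  rw [β₂_eq]
  exact div_pos log_pi_div_two_pos (by linarith [log_pi_div_two_lt_half])

theorem β₂_div_one_add : β₂ / (1 + β₂) = log (π / 2) := by
  have h : 1 - log (π / 2) ≠ 0 := by linarith [log_pi_div_two_lt_half]
  rw [β₂_eq]
  field_simp
  ring

theorem sinc_pi_div_two : sinc (π / 2) = (π / 2)⁻¹ := by
  rw [sinc_of_ne_zero (by positivity), sin_pi_div_two, one_div]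

theorem Pm_comm (a b : ℝ) : Pm a b = Pm b a := by
  rw [Pm, Pm, ← neg_sub b a, add_comm a b, neg_div (b + a), arcsin_neg, mul_neg,
    neg_div_neg_eq]

theorem Am_comm (a b : ℝ) : Am a b = Am b a := by rw [Am, Am, add_comm]

theorem Xm_comm (a b : ℝ) : Xm a b = Xm b a := by
  rw [Xm, Xm, Am_comm, Pm_comm, Gm, Gm, mul_comm a b]

/-- The mean `X` of `1 + sin t` and `1 - sin t`. -/
noncomputable def unitXm (t : ℝ) : ℝ := exp (cos t / sinc t - 1)

theorem Am_mul_one_add_sin (A t : ℝ) : Am (A * (1 + sin t)) (A * (1 - sin t)) = A := by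
  rw [Am]
  ring

theorem Pm_mul_one_add_sin {A t : ℝ} (hA : 0 < A) (ht : t ∈ Set.Ioo 0 (π / 2)) :
    Pm (A * (1 + sin t)) (A * (1 - sin t)) = A * sinc t := by
  have h : (A * (1 + sin t) - A * (1 - sin t)) / (A * (1 + sin t) + A * (1 - sin t)) = sin t := by
    field_simp
    ring
  rw [Pm, h, arcsin_sin (by linarith [ht.1, pi_pos]) ht.2.le, sinc_of_ne_zero ht.1.ne']
  have := ht.1.ne'
  field_simp
  ring

theorem Xm_mul_one_add_sin {A t : ℝ} (hA : 0 < A) (ht : t ∈ Set.Ioo 0 (π / 2)) :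
    Xm (A * (1 + sin t)) (A * (1 - sin t)) = A * unitXm t := by
  have hG : Gm (A * (1 + sin t)) (A * (1 - sin t)) = A * cos t := by
    have h : A * (1 + sin t) * (A * (1 - sin t)) = (A * cos t) ^ 2 := by
      linear_combination A ^ 2 * (-sin_sq_add_cos_sq t)
    rw [Gm, h, sqrt_sq (mul_pos hA (cos_pos_of_mem_Ioo_pi_div_two ht)).le]
  rw [Xm, hG, Am_mul_one_add_sin, Pm_mul_one_add_sin hA ht, mul_div_mul_left _ _ hA.ne', unitXm]

theorem exists_eq_mul_one_add_sin {a b : ℝ} (hb : 0 < b) (hab : b < a) :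
    ∃ A t, 0 < A ∧ t ∈ Set.Ioo 0 (π / 2) ∧ a = A * (1 + sin t) ∧ b = A * (1 - sin t) := by
  have hs : 0 < a + b := by linarith
  have h0 : 0 < (a - b) / (a + b) := div_pos (by linarith) hs
  have h1 : (a - b) / (a + b) < 1 := by
    rw [div_lt_one hs]
    linarith
  refine ⟨(a + b) / 2, arcsin ((a - b) / (a + b)), by linarith,
    ⟨arcsin_pos.2 h0, arcsin_lt_pi_div_two.2 h1⟩, ?_, ?_⟩ <;>
  · rw [sin_arcsin (by linarith) h1.le]
    field_simp
    ring

theorem sin_lt_one_of_mem_Ioo_pi_div_two {t : ℝ} (ht : t ∈ Set.Ioo 0 (π / 2)) : sin t < 1 := by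
  rw [← sin_pi_div_two]
  exact sin_lt_sin_of_lt_of_le_pi_div_two (by linarith [ht.1, pi_pos]) le_rfl ht.2

theorem exists_means_eq {A t : ℝ} (hA : 0 < A) (ht : t ∈ Set.Ioo 0 (π / 2)) :
    ∃ a b, 0 < a ∧ 0 < b ∧ a ≠ b ∧ Am a b = A ∧ Pm a b = A * sinc t ∧ Xm a b = A * unitXm t := by
  have h0 := sin_pos_of_mem_Ioo_pi_div_two ht
  have h1 := sin_lt_one_of_mem_Ioo_pi_div_two ht
  refine ⟨A * (1 + sin t), A * (1 - sin t), by positivity, mul_pos hA (by linarith), ?_,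
    Am_mul_one_add_sin A t, Pm_mul_one_add_sin hA ht, Xm_mul_one_add_sin hA ht⟩
  intro h
  have := mul_left_cancel₀ hA.ne' h
  linarith

theorem mul_rpow_mean {A β : ℝ} (hA : 0 < A) (hβ : 0 < β) (t : ℝ) :
    (A * (A * unitXm t) ^ β) ^ (1 / (1 + β)) =
      A * exp ((cos t / sinc t - 1) * (β / (1 + β))) := by
  obtain ⟨x, rfl⟩ : ∃ x, exp x = A := ⟨log A, exp_log hA⟩
  rw [unitXm, ← exp_add, ← exp_mul, ← exp_add, ← exp_mul, ← exp_add]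
  congr 1
  field_simp
  ring

theorem sqrt_Am_mul_Xm_lt_Pm_lt {a b : ℝ} (hb : 0 < b) (hab : b < a) :
    (Am a b * Xm a b) ^ ((1 : ℝ) / 2) < Pm a b ∧
      Pm a b < (Am a b * Xm a b ^ β₂) ^ (1 / (1 + β₂)) := by
  obtain ⟨A, t, hA, ht, rfl, rfl⟩ := exists_eq_mul_one_add_sin hb hab
  have hpos : 0 < sinc t := sinc_pos_of_mem_Icc_pi_div_two ⟨ht.1.le, ht.2.le⟩
  rw [Am_mul_one_add_sin, Pm_mul_one_add_sin hA ht, Xm_mul_one_add_sin hA ht]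
  constructor
  · have h := mul_rpow_mean hA one_pos t
    rw [rpow_one, one_add_one_eq_two] at h
    rw [h]
    refine mul_lt_mul_of_pos_left ((lt_log_iff_exp_lt hpos).1 ?_) hA
    have := logMeanGap_two_neg t ht
    rw [logMeanGap] at this
    linarith
  · rw [mul_rpow_mean hA β₂_pos, β₂_div_one_add]
    refine mul_lt_mul_of_pos_left ((log_lt_iff_lt_exp hpos).1 ?_) hA
    have hl := log_pi_div_two_pos
    have hk : 2 ≤ (log (π / 2))⁻¹ := by
      rw [le_inv_comm₀ two_pos hl]
      linarith [log_pi_div_two_lt_half]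
    have := logMeanGap_pos hk
      (by simp only [logMeanGap, sinc_pi_div_two, log_inv, cos_pi_div_two]; field_simp; simp) t ht
    rw [logMeanGap, sub_pos, inv_mul_lt_iff₀ hl] at this
    linarith

theorem exists_not_Am_mul_Xm_rpow_lt_Pm {e : ℝ} (he : e ≠ 1 / 2) :
    ∃ a b : ℝ, 0 < a ∧ 0 < b ∧ a ≠ b ∧ ¬ (Am a b * Xm a b) ^ e < Pm a b := by
  have ht : π / 4 ∈ Set.Ioo 0 (π / 2) := ⟨by positivity, by linarith [pi_pos]⟩
  have hpos : 0 < sinc (π / 4) := sinc_pos_of_mem_Icc_pi_div_two ⟨ht.1.le, ht.2.le⟩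
  have hX : 0 < unitXm (π / 4) := exp_pos _
  have he' : 2 * e - 1 ≠ 0 := fun h => he (by linarith)
  set q := sinc (π / 4) / unitXm (π / 4) ^ e with hq
  have hq0 : 0 < q := by positivity
  obtain ⟨A, hA, hAq⟩ : ∃ A, 0 < A ∧ A ^ (2 * e - 1) = q :=
    ⟨q ^ (2 * e - 1)⁻¹, by positivity, rpow_inv_rpow hq0.le he'⟩
  obtain ⟨a, b, ha, hb, hab, h1, h2, h3⟩ := exists_means_eq hA ht
  refine ⟨a, b, ha, hb, hab, ?_⟩
  rw [h1, h2, h3, not_lt]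
  have h4 : (A * (A * unitXm (π / 4))) ^ e = A * A ^ (2 * e - 1) * unitXm (π / 4) ^ e := by
    rw [← mul_assoc, mul_rpow (by positivity) hX.le, mul_rpow hA.le hA.le, ← rpow_add hA,
      rpow_sub_one hA.ne', mul_div_cancel₀ _ hA.ne', two_mul]
  rw [h4, hAq, hq, mul_assoc, div_mul_cancel₀ _ (by positivity)]

theorem exists_not_Pm_lt_rpow {β : ℝ} (hβ : β₂ < β) :
    ∃ a b : ℝ, 0 < a ∧ 0 < b ∧ a ≠ b ∧
      ¬ Pm a b < (Am a b * Xm a b ^ β) ^ (1 / (1 + β)) := by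
  have hβ0 : 0 < β := β₂_pos.trans hβ
  have hlt : log (π / 2) < β / (1 + β) := by
    rw [← β₂_div_one_add, div_lt_div_iff₀ (by linarith [β₂_pos]) (by linarith)]
    linarith
  have hne : sinc (π / 2) ≠ 0 := by
    rw [sinc_pi_div_two]
    positivity
  have hc : ContinuousAt (fun t => exp ((cos t / sinc t - 1) * (β / (1 + β)))) (π / 2) :=
    (((continuous_cos.continuousAt.div continuous_sinc.continuousAt hne).sub
      continuousAt_const).mul continuousAt_const).rexp
  have hend : exp ((cos (π / 2) / sinc (π / 2) - 1) * (β / (1 + β))) < sinc (π / 2) := by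
    rw [sinc_pi_div_two, ← lt_log_iff_exp_lt (by positivity), log_inv, cos_pi_div_two,
      zero_div, zero_sub, neg_one_mul, neg_lt_neg_iff]
    exact hlt
  have hev := (hc.eventually_lt continuous_sinc.continuousAt hend).filter_mono
    (nhdsWithin_le_nhds (s := Set.Iio (π / 2)))
  obtain ⟨t, h, ht⟩ := (hev.and (Ioo_mem_nhdsLT (by positivity : (0 : ℝ) < π / 2))).exists
  obtain ⟨a, b, ha, hb, hab, h1, h2, h3⟩ := exists_means_eq one_pos ht
  refine ⟨a, b, ha, hb, hab, ?_⟩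
  rw [h1, h2, h3, mul_rpow_mean one_pos hβ0, not_lt]
  simpa using h.le

theorem stmt_8 :
    (∀ a b : ℝ, 0 < a → 0 < b → a ≠ b →
      (Am a b * Xm a b) ^ ((1 : ℝ) / 2) < Pm a b ∧
      Pm a b < (Am a b * Xm a b ^ β₂) ^ (1 / (1 + β₂))) ∧
    -- the exponent 2 is best possible
    (∀ α : ℝ, α ≠ 2 → ∃ a b : ℝ, 0 < a ∧ 0 < b ∧ a ≠ b ∧
      ¬ (Am a b * Xm a b) ^ (1 / α) < Pm a b) ∧
    -- the exponent β₂ is best possible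
    (∀ β : ℝ, β₂ < β → ∃ a b : ℝ, 0 < a ∧ 0 < b ∧ a ≠ b ∧
      ¬ Pm a b < (Am a b * Xm a b ^ β) ^ (1 / (1 + β))) := by
  refine ⟨fun a b ha hb hab => ?_, fun α hα => exists_not_Am_mul_Xm_rpow_lt_Pm fun h => hα ?_,
    fun β hβ => exists_not_Pm_lt_rpow hβ⟩
  · rcases hab.lt_or_gt with h | h
    · rw [Am_comm, Pm_comm, Xm_comm]
      exact sqrt_Am_mul_Xm_lt_Pm_lt ha h
    · exact sqrt_Am_mul_Xm_lt_Pm_lt hb h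
  · simpa using h
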